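/- arXiv:0709.1429 — 3 statements merged into one kernel-verified Lean document; each statement's English description precedes it below -/
import Mathlib

section
/- There are exactly 298 orbits of orientation-reversing gluing patterns of the faces of the octahedron under the action of the symmetry group of the octahedron; that is, there exist exactly 298 combinatorially inequivalent orientation-reversing gluing patterns. -/
/-! Combinatorial model of the octahedron and of orientation-reversing gluing
patterns of its faces, following Heard–Pervova–Petronio. -/

/-- Vertices of the octahedron `±e_i`, encoded as a pair (axis, sign). -/
abbrev OctVertex : Type := Fin 3 × Bool

/-- Faces of the octahedron: a choice of a sign for each coordinate axis;
the face `F` has vertex set `{(i, F i) : i ∈ Fin 3}`. -/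
abbrev OctFace : Type := Fin 3 → Bool

/-- The parity of a face.  The cyclic order (axis 0, axis 1, axis 2) of the vertices of
a face `F` agrees with the cyclic order induced by the outward orientation of the
boundary of the solid octahedron if and only if `faceSign F = true`. -/
def faceSign (F : OctFace) : Bool := Bool.xor (F 0) (Bool.xor (F 1) (F 2))

/-- `IsGluing σ π` says that the fixed-point-free involution `σ` of the set of faces,
together with the face identifications `π` (the bijection `φ_F` from the vertices of `F`
to those of `σ F` sends the vertex of `F` on axis `i` to the vertex of `σ F` on axis
`π F i`), is an orientation-reversing gluing pattern: `φ_{σ F} = φ_F⁻¹` and every `φ_F`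
reverses the cyclic orderings induced by the boundary orientation (a bijection
`F → σ F` given by `π` reverses them iff `sign (π) · faceSign F · faceSign (σ F) = -1`). -/
def IsGluing (σ : Equiv.Perm OctFace) (π : OctFace → Equiv.Perm (Fin 3)) : Prop :=
  (∀ F, σ (σ F) = F) ∧ (∀ F, σ F ≠ F) ∧ (∀ F, π (σ F) = (π F)⁻¹) ∧
    (∀ F, Equiv.Perm.sign (π F) = 1 ↔ faceSign F ≠ faceSign (σ F))

instance : DecidablePred fun p : Equiv.Perm OctFace × (OctFace → Equiv.Perm (Fin 3)) =>
    IsGluing p.1 p.2 := fun p => by unfold IsGluing; infer_instance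

/-- An orientation-reversing gluing pattern of the faces of the octahedron. -/
abbrev Gluing : Type :=
  {p : Equiv.Perm OctFace × (OctFace → Equiv.Perm (Fin 3)) // IsGluing p.1 p.2}

/-- The involution on faces underlying a gluing pattern. -/
def Gluing.face (g : Gluing) : Equiv.Perm OctFace := g.1.1

/-- The face identifications of a gluing pattern, as permutations of the axes. -/
def Gluing.axisMap (g : Gluing) : OctFace → Equiv.Perm (Fin 3) := g.1.2

/-- The action of the symmetry of the octahedron given by the signed axis permutation
`(ρ, ε)` (sending the vertex `(i, b)` to `(ρ i, xor b (ε i))`) on faces. -/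
def symMapFace (ρ : Equiv.Perm (Fin 3)) (ε : Fin 3 → Bool) (F : OctFace) : OctFace :=
  fun j => Bool.xor (F (ρ⁻¹ j)) (ε (ρ⁻¹ j))

/-- Two gluing patterns are combinatorially equivalent if some symmetry of the
octahedron conjugates one into the other. -/
def EquivGluing (g h : Gluing) : Prop :=
  ∃ (ρ : Equiv.Perm (Fin 3)) (ε : Fin 3 → Bool),
    (∀ F, h.face (symMapFace ρ ε F) = symMapFace ρ ε (g.face F)) ∧
    (∀ F, h.axisMap (symMapFace ρ ε F) = ρ * g.axisMap F * ρ⁻¹)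

/-- The combinatorial equivalence class (orbit under the symmetry group) of a gluing. -/
def orbit (g : Gluing) : Set Gluing := {h | EquivGluing g h}

/-- The identifications induced by a gluing pattern on the vertices of the octahedron:
the vertex of `F` on axis `i` is glued to the corresponding vertex of `face F`. -/
def vtxRel (g : Gluing) (v w : OctVertex) : Prop :=
  ∃ (F : OctFace) (i : Fin 3),
    v = (i, F i) ∧ w = (g.axisMap F i, g.face F (g.axisMap F i))

/-- The equivalence relation on vertices generated by the face identifications. -/
def vtxSetoid (g : Gluing) : Setoid OctVertex := Relation.EqvGen.setoid (vtxRel g)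

/-- The number of vertex classes of a gluing pattern. -/
noncomputable def vtxCount (g : Gluing) : ℕ := Nat.card (Quotient (vtxSetoid g))

/-- An edge-end (corner) of the octahedron: an ordered pair of vertices lying on
distinct axes; it represents the edge between them together with the choice of the
first vertex as its endpoint.  Edge-ends correspond to the corners of the
quadrilateral vertex links. -/
abbrev EdgeEnd : Type := {p : OctVertex × OctVertex // p.1.1 ≠ p.2.1}

/-- The identifications induced by a gluing pattern on edge-ends: an edge-end contained
in the face `F` is glued to the corresponding edge-end of `face F`. -/
def endRel (g : Gluing) (p q : EdgeEnd) : Prop :=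
  ∃ (F : OctFace) (i j : Fin 3), i ≠ j ∧ p.1 = ((i, F i), (j, F j)) ∧
    q.1 = ((g.axisMap F i, g.face F (g.axisMap F i)),
           (g.axisMap F j, g.face F (g.axisMap F j)))

/-- The equivalence relation on edge-ends generated by the face identifications.
Its classes are the vertices of the quadrangulated link surfaces of the vertex
classes. -/
def endSetoid (g : Gluing) : Setoid EdgeEnd := Relation.EqvGen.setoid (endRel g)

/-- The relation on edge-ends generating the edge identifications: face identifications
together with forgetting the choice of endpoint. -/
def edgeRel (g : Gluing) (p q : EdgeEnd) : Prop :=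
  endRel g p q ∨ q.1 = (p.1.2, p.1.1)

/-- The equivalence relation whose classes are the edge classes of a gluing pattern. -/
def edgeSetoid (g : Gluing) : Setoid EdgeEnd := Relation.EqvGen.setoid (edgeRel g)

/-- The number of edge classes of a gluing pattern. -/
noncomputable def edgeCount (g : Gluing) : ℕ := Nat.card (Quotient (edgeSetoid g))

/-- The number of vertices of the octahedron lying in the vertex class `c`; this is
the number of quadrilaterals tiling the link surface of `c`. -/
noncomputable def classSize (g : Gluing) (c : Quotient (vtxSetoid g)) : ℕ :=
  Nat.card {v : OctVertex // Quotient.mk (vtxSetoid g) v = c}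

/-- The number of vertices of the quadrangulated link surface of the vertex class `c`:
the number of classes of edge-ends whose endpoint lies in `c`. -/
noncomputable def cornerCount (g : Gluing) (c : Quotient (vtxSetoid g)) : ℕ :=
  Nat.card {q : Quotient (endSetoid g) //
    ∃ p : EdgeEnd, Quotient.mk (endSetoid g) p = q ∧ Quotient.mk (vtxSetoid g) p.1.1 = c}

/-- The Euler characteristic of the link surface of the vertex class `c`: the link is
tiled by `classSize g c` quadrilaterals, with `2 * classSize g c` edges and
`cornerCount g c` vertices, so `χ = cornerCount - 2 * classSize + classSize`. -/
noncomputable def linkChi (g : Gluing) (c : Quotient (vtxSetoid g)) : ℤ :=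
  (cornerCount g c : ℤ) - (classSize g c : ℤ)

/-- All vertex links are 2-spheres: the quotient space is a closed manifold. -/
def AllLinksSphere (g : Gluing) : Prop := ∀ c, linkChi g c = 2

/-- The non-sphere vertex-link data consists of a single torus. -/
def LinksOneTorus (g : Gluing) : Prop :=
  (∀ c, linkChi g c = 2 ∨ linkChi g c = 0) ∧
    Nat.card {c : Quotient (vtxSetoid g) // linkChi g c = 0} = 1

/-- The non-sphere vertex-link data consists of two tori. -/
def LinksTwoTori (g : Gluing) : Prop :=
  (∀ c, linkChi g c = 2 ∨ linkChi g c = 0) ∧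
    Nat.card {c : Quotient (vtxSetoid g) // linkChi g c = 0} = 2

/-- The non-sphere vertex-link data consists of a single genus-2 surface. -/
def LinksGenusTwo (g : Gluing) : Prop :=
  (∀ c, linkChi g c = 2 ∨ linkChi g c = -2) ∧
    Nat.card {c : Quotient (vtxSetoid g) // linkChi g c = -2} = 1

/-- The non-sphere vertex-link data consists of one genus-2 surface and one torus. -/
def LinksGenusTwoTorus (g : Gluing) : Prop :=
  (∀ c, linkChi g c = 2 ∨ linkChi g c = 0 ∨ linkChi g c = -2) ∧
    Nat.card {c : Quotient (vtxSetoid g) // linkChi g c = 0} = 1 ∧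
    Nat.card {c : Quotient (vtxSetoid g) // linkChi g c = -2} = 1

/-- The non-sphere vertex-link data consists of a single genus-3 surface. -/
def LinksGenusThree (g : Gluing) : Prop :=
  (∀ c, linkChi g c = 2 ∨ linkChi g c = -4) ∧
    Nat.card {c : Quotient (vtxSetoid g) // linkChi g c = -4} = 1

/-! The geometric realization: the solid octahedron in `ℝ³` and the quotient
space `X(φ)` of a gluing pattern `φ`. -/

/-- The point `±e_i` of `ℝ³` corresponding to a vertex of the octahedron. -/
def vertexPt (v : OctVertex) : Fin 3 → ℝ :=
  fun j => if j = v.1 then (if v.2 then 1 else -1) else 0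

/-- The solid octahedron: the convex hull of `{±e₁, ±e₂, ±e₃}` in `ℝ³`. -/
def SolidOcta : Set (Fin 3 → ℝ) := convexHull ℝ (Set.range vertexPt)

theorem vertexPt_mem_solidOcta (v : OctVertex) : vertexPt v ∈ SolidOcta :=
  subset_convexHull ℝ _ (Set.mem_range_self v)

/-- The gluing relation on the solid octahedron: the point of the closed triangular face
of `F` with barycentric coordinates `w` is glued to the point of the face of
`face F` with the corresponding barycentric coordinates, i.e. the faces
are identified via the affine extensions of the combinatorial identifications. -/
def glueRel (g : Gluing) (x y : SolidOcta) : Prop :=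
  ∃ (F : OctFace) (w : Fin 3 → ℝ), (∀ i, 0 ≤ w i) ∧ (∑ i, w i) = 1 ∧
    (x : Fin 3 → ℝ) = ∑ i, w i • vertexPt (i, F i) ∧
    (y : Fin 3 → ℝ) = ∑ i, w i • vertexPt (g.axisMap F i, g.face F (g.axisMap F i))

/-- The equivalence relation on the solid octahedron generated by the affine face
identifications of a gluing pattern. -/
def glueSetoid (g : Gluing) : Setoid SolidOcta := Relation.EqvGen.setoid (glueRel g)

/-- The quotient space `X(φ)` of the solid octahedron by the gluing pattern `φ`,
with the quotient topology. -/
abbrev XSpace (g : Gluing) : Type := Quotient (glueSetoid g)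

namespace OctCount

/-! ### The symmetry group and its action -/

/-- Signed axis permutations. -/
@[ext] structure Sym where
  ρ : Equiv.Perm (Fin 3)
  ε : Fin 3 → Bool

namespace Sym

instance : Mul Sym := ⟨fun a b => ⟨a.ρ * b.ρ, fun i => Bool.xor (b.ε i) (a.ε (b.ρ i))⟩⟩
instance : One Sym := ⟨⟨1, fun _ => false⟩⟩
instance : Inv Sym := ⟨fun a => ⟨a.ρ⁻¹, fun i => a.ε (a.ρ⁻¹ i)⟩⟩

@[simp] theorem mul_rho (a b : Sym) : (a * b).ρ = a.ρ * b.ρ := rfl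
@[simp] theorem mul_eps (a b : Sym) (i : Fin 3) :
    (a * b).ε i = Bool.xor (b.ε i) (a.ε (b.ρ i)) := rfl
@[simp] theorem one_rho : (1 : Sym).ρ = 1 := rfl
@[simp] theorem one_eps (i : Fin 3) : (1 : Sym).ε i = false := rfl
@[simp] theorem inv_rho (a : Sym) : (a⁻¹).ρ = a.ρ⁻¹ := rfl
@[simp] theorem inv_eps (a : Sym) (i : Fin 3) : (a⁻¹).ε i = a.ε (a.ρ⁻¹ i) := rfl

instance : Group Sym :=
  Group.ofLeftAxioms
    (fun a b c => by
      ext i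
      · simp [mul_assoc]
      · simp)
    (fun a => by
      ext i
      · simp
      · simp)
    (fun a => by
      ext i
      · simp
      · simp)

/-- The underlying pairs. -/
def equivProd : Sym ≃ Equiv.Perm (Fin 3) × OctFace where
  toFun a := (a.ρ, a.ε)
  invFun p := ⟨p.1, p.2⟩
  left_inv _ := rfl
  right_inv _ := rfl

instance : Fintype Sym := Fintype.ofEquiv _ equivProd.symm

theorem card_eq : Fintype.card Sym = 48 := by
  rw [Fintype.card_congr equivProd]
  simp [Fintype.card_perm, Nat.factorial]

theorem map_mul' (a b : Sym) (F : OctFace) :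
    symMapFace (a * b).ρ (a * b).ε F = symMapFace a.ρ a.ε (symMapFace b.ρ b.ε F) := by
  funext j
  simp [symMapFace]

theorem map_one' (F : OctFace) : symMapFace (1 : Sym).ρ (1 : Sym).ε F = F := by
  funext j
  simp [symMapFace]

/-- The permutation of the faces induced by a symmetry. -/
def onFace (a : Sym) : Equiv.Perm OctFace where
  toFun F := symMapFace a.ρ a.ε F
  invFun F := symMapFace (a⁻¹).ρ (a⁻¹).ε F
  left_inv F := by
    change symMapFace (a⁻¹).ρ (a⁻¹).ε (symMapFace a.ρ a.ε F) = F
    rw [← map_mul', inv_mul_cancel, map_one']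
  right_inv F := by
    change symMapFace a.ρ a.ε (symMapFace (a⁻¹).ρ (a⁻¹).ε F) = F
    rw [← map_mul', mul_inv_cancel, map_one']

theorem onFace_apply (a : Sym) (F : OctFace) : a.onFace F = symMapFace a.ρ a.ε F := rfl

theorem onFace_mul (a b : Sym) : (a * b).onFace = a.onFace * b.onFace := by
  ext1 F
  exact map_mul' a b F

theorem onFace_one : (1 : Sym).onFace = 1 := by
  ext1 F
  exact map_one' F

theorem faceSign_map' : ∀ (ρ : Equiv.Perm (Fin 3)) (ε F : OctFace),
    faceSign (symMapFace ρ ε F) = Bool.xor (faceSign F) (faceSign ε) := by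
  decide +kernel

theorem faceSign_map (ρ : Equiv.Perm (Fin 3)) (ε F G : OctFace) :
    (faceSign (symMapFace ρ ε F) ≠ faceSign (symMapFace ρ ε G)) ↔ faceSign F ≠ faceSign G := by
  simp [faceSign_map']

/-- The action of a symmetry on a gluing pattern. -/
def act (a : Sym) (g : Gluing) : Gluing :=
  ⟨(a.onFace * g.face * a.onFace⁻¹,
    fun F => a.ρ * g.axisMap (a.onFace⁻¹ F) * a.ρ⁻¹), by
    obtain ⟨h1, h2, h3, h4⟩ := g.2
    change ∀ F, g.face (g.face F) = F at h1
    change ∀ F, g.face F ≠ F at h2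
    change ∀ F, g.axisMap (g.face F) = (g.axisMap F)⁻¹ at h3
    change ∀ F, Equiv.Perm.sign (g.axisMap F) = 1 ↔ faceSign F ≠ faceSign (g.face F) at h4
    refine ⟨fun F => ?_, fun F => ?_, fun F => ?_, fun F => ?_⟩
    · simp [h1]
    · simp only [Equiv.Perm.mul_apply, ne_eq]
      intro h
      apply h2 (a.onFace⁻¹ F)
      apply a.onFace.injective
      rw [h]
      simp
    · simp [h3, mul_assoc]
    · obtain ⟨F, rfl⟩ := a.onFace.surjective F
      have hF : a.onFace⁻¹ (a.onFace F) = F := by simp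
      simp only [Equiv.Perm.mul_apply, hF]
      rw [onFace_apply, onFace_apply, faceSign_map, ← h4]
      simp [mul_right_comm]⟩

theorem act_face (a : Sym) (g : Gluing) :
    (act a g).face = a.onFace * g.face * a.onFace⁻¹ := rfl
theorem act_axis (a : Sym) (g : Gluing) (F : OctFace) :
    (act a g).axisMap F = a.ρ * g.axisMap (a.onFace⁻¹ F) * a.ρ⁻¹ := rfl

theorem gluing_ext {g h : Gluing} (h1 : g.face = h.face) (h2 : ∀ F, g.axisMap F = h.axisMap F) :
    g = h :=
  Subtype.ext (Prod.ext h1 (funext h2))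

instance : MulAction Sym Gluing where
  smul := act
  one_smul g := by
    change act 1 g = g
    apply gluing_ext
    · simp [act_face, onFace_one]
    · simp [act_axis, onFace_one]
  mul_smul a b g := by
    change act (a * b) g = act a (act b g)
    apply gluing_ext
    · simp [act_face, onFace_mul, mul_assoc]
    · simp [act_axis, onFace_mul, mul_assoc]

theorem smul_eq_iff (a : Sym) (g h : Gluing) : a • g = h ↔
    (∀ F, h.face (symMapFace a.ρ a.ε F) = symMapFace a.ρ a.ε (g.face F)) ∧
    (∀ F, h.axisMap (symMapFace a.ρ a.ε F) = a.ρ * g.axisMap F * a.ρ⁻¹) := by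
  change act a g = h ↔ _
  constructor
  · rintro rfl
    simp only [← onFace_apply]
    constructor
    · simp [act_face]
    · simp [act_axis]
  · rintro ⟨h1, h2⟩
    simp only [← onFace_apply] at h1 h2
    apply gluing_ext
    · ext1 F
      obtain ⟨F, rfl⟩ := a.onFace.surjective F
      simp [act_face, h1]
    · intro F
      obtain ⟨F, rfl⟩ := a.onFace.surjective F
      simp [act_axis, h2]

theorem orbit_eq (g : Gluing) : _root_.orbit g = MulAction.orbit Sym g := by
  ext h
  constructor
  · rintro ⟨ρ, ε, h1⟩
    exact ⟨⟨ρ, ε⟩, (smul_eq_iff ⟨ρ, ε⟩ g h).2 h1⟩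
  · rintro ⟨a, ha⟩
    exact ⟨a.ρ, a.ε, (smul_eq_iff a g h).1 ha⟩

end Sym

theorem card_orbits : Nat.card {s : Set Gluing // ∃ g : Gluing, s = orbit g} =
    Nat.card (Quotient (MulAction.orbitRel Sym Gluing)) := by
  symm
  refine Nat.card_congr (Equiv.ofBijective
    (fun q : MulAction.orbitRel.Quotient Sym Gluing => ⟨q.orbit, ?_⟩) ⟨?_, ?_⟩)
  · induction q using Quotient.inductionOn' with
    | h g => exact ⟨g, by rw [Sym.orbit_eq]; rfl⟩
  · intro q r h
    exact MulAction.orbitRel.Quotient.orbit_injective (congrArg Subtype.val h)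
  · rintro ⟨s, g, rfl⟩
    exact ⟨Quotient.mk'' g, Subtype.ext (Sym.orbit_eq g).symm⟩

/-! ### Numerical codes -/

/-- The `i`-th digit of `c` in base 64. -/
def lk (c i : ℕ) : ℕ := Nat.land (Nat.shiftRight c (Nat.mul (nat_lit 6) i)) (nat_lit 63)

theorem lk_eq (c i : ℕ) : lk c i = c / 64 ^ i % 64 := by
  change (c >>> (6 * i)) &&& 63 = _
  rw [Nat.shiftRight_eq_div_pow, pow_mul, show (63 : ℕ) = 2 ^ 6 - 1 from rfl,
    Nat.and_two_pow_sub_one_eq_mod]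
  norm_num

theorem lk_lt (c i : ℕ) : lk c i < 64 := by
  rw [lk_eq]; exact Nat.mod_lt _ (by norm_num)

/-- The table (in base 64) of the effect of the axis permutation number 0 on
the codes of pairs (face, axis permutation). -/
def tab0 : ℕ := nat_lit 9311821635039837955512368127886330548079973591624813520167021264505054541081692061351859309196672242890203471936

/-- The table (in base 64) of the effect of the axis permutation number 1 on
the codes of pairs (face, axis permutation). -/
def tab1 : ℕ := nat_lit 8858591332666300026246838934506005291524793243489387787090112837077615322594070604897379934423605574151311478848

/-- The table (in base 64) of the effect of the axis permutation number 2 on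
the codes of pairs (face, axis permutation). -/
def tab2 : ℕ := nat_lit 8708282923080732387733587093784209121378600681490133766335560180990598148262180663905807347530439535685295677760

/-- The table (in base 64) of the effect of the axis permutation number 3 on
the codes of pairs (face, axis permutation). -/
def tab3 : ℕ := nat_lit 8860900921608509231742838567239569556547046651346517975974024644815518111924753315654234199197332007689506263360

/-- The table (in base 64) of the effect of the axis permutation number 4 on
the codes of pairs (face, axis permutation). -/
def tab4 : ℕ := nat_lit 8710596462932671134673434630995856895993599029227323865208471561315966354463159724329924396405211888096153194624

/-- The table (in base 64) of the effect of the axis permutation number 5 on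
the codes of pairs (face, axis permutation). -/
def tab5 : ℕ := nat_lit 9309509224019231907057117005702117838485674076337310108728724679213990524363029370963693899122118199435481583744

/-- The tables of the six axis permutations. -/
def tabs : List ℕ := [tab0, tab1, tab2, tab3, tab4, tab5]

/-- Index of the inverse of an axis permutation. -/
def invIdx (p : ℕ) : ℕ := [0, 1, 2, 4, 3, 5].getD p 0

/-- Parity of a face index. -/
def oddFace (F : ℕ) : Bool := F == 1 || F == 2 || F == 4 || F == 7

/-- The orientation-reversing bijections between two faces. -/
def choices (F G : ℕ) : List ℕ := bif xor (oddFace F) (oddFace G) then [4, 3, 0] else [5, 2, 1]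

/-- Contribution to the code of the gluing of `F` to `G` by `p`. -/
def pairCode (F G p : ℕ) : ℕ := 64 ^ F * (8 * G + p) + 64 ^ G * (8 * F + invIdx p)

/-- All codes of gluings of the faces in a list. -/
def enumCodes : ℕ → List ℕ → List ℕ
  | 0, _ => [0]
  | _ + 1, [] => [0]
  | n + 1, F :: rest => rest.flatMap fun G => (choices F G).flatMap fun p =>
      (enumCodes n (rest.erase G)).map fun c => pairCode F G p + c

/-- Invariance test at a face. -/
def checkAt (T m c F : ℕ) : Bool :=
  Nat.beq (lk c (Nat.shiftRight (lk T (Nat.shiftLeft (Nat.xor F m) (nat_lit 3))) (nat_lit 3))) (lk T (Nat.xor (lk c F) (Nat.shiftLeft m (nat_lit 3))))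

/-- Invariance test of a code. -/
def check (T m c : ℕ) : Bool := (checkAt T m c (nat_lit 0)).and ((checkAt T m c (nat_lit 1)).and ((checkAt T m c (nat_lit 2)).and ((checkAt T m c (nat_lit 3)).and ((checkAt T m c (nat_lit 4)).and ((checkAt T m c (nat_lit 5)).and ((checkAt T m c (nat_lit 6)).and (checkAt T m c (nat_lit 7))))))))

/-- Number of symmetries fixing a code, averaged over conjugacy classes: the nontrivial
conjugacy classes are tested on one representative and weighted by their size. -/
def fixNum (c : ℕ) : ℕ :=
  Nat.add (nat_lit 1)
    (Nat.add (cond (check tab0 (nat_lit 1) c) (nat_lit 3) (nat_lit 0))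
    (Nat.add (cond (check tab0 (nat_lit 3) c) (nat_lit 3) (nat_lit 0))
    (Nat.add (cond (check tab0 (nat_lit 7) c) (nat_lit 1) (nat_lit 0))
    (Nat.add (cond (check tab1 (nat_lit 0) c) (nat_lit 6) (nat_lit 0))
    (Nat.add (cond (check tab1 (nat_lit 1) c) (nat_lit 6) (nat_lit 0))
    (Nat.add (cond (check tab1 (nat_lit 4) c) (nat_lit 6) (nat_lit 0))
    (Nat.add (cond (check tab1 (nat_lit 5) c) (nat_lit 6) (nat_lit 0))
    (Nat.add (cond (check tab3 (nat_lit 0) c) (nat_lit 8) (nat_lit 0))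
    ((cond (check tab3 (nat_lit 1) c) (nat_lit 8) (nat_lit 0)))))))))))

/-- Sum of `fixNum`; the matching on the head forces its evaluation. -/
def sumF : List ℕ → ℕ
  | [] => 0
  | Nat.zero :: l => Nat.add (fixNum Nat.zero) (sumF l)
  | (Nat.succ c) :: l => Nat.add (fixNum (Nat.succ c)) (sumF l)

/-- The codes in which face 7 is glued to face `G` by `p`. -/
def branch (G p : ℕ) : List ℕ :=
  (enumCodes 3 ([6, 5, 4, 3, 2, 1, 0].erase G)).map fun c => pairCode 7 G p + c

/-- All codes. -/
def allCodes : List ℕ := enumCodes 4 [7, 6, 5, 4, 3, 2, 1, 0]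

/-- The possible gluings of face 7. -/
def tops : List (ℕ × ℕ) :=
  [6, 5, 4, 3, 2, 1, 0].flatMap fun G => (choices 7 G).map fun p => (G, p)

theorem allCodes_eq : allCodes = tops.flatMap fun t => branch t.1 t.2 := by
  simp [tops, List.flatMap_map, allCodes, enumCodes, branch]

set_option maxRecDepth 100000 in
theorem sum_branches : (tops.map fun t => sumF (branch t.1 t.2)).sum = 14304 := by
  decide +kernel

/-- The bit `64 * i + e` tells whether `e` is an admissible digit at position `i`. -/
def okMask : ℕ := nat_lit 5134770948680097725884011662991584171494097474870172855876158882259471464235714313777414028646823280485145621483467020824279328498939140643935227549952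

/-- Validity of the digit `e` at position `i` of `c`. -/
def validEnt (c i e : ℕ) : Bool :=
  (Nat.beq (Nat.land (Nat.shiftRight okMask (Nat.add (Nat.mul (nat_lit 64) i) e)) (nat_lit 1))
    (nat_lit 1)).and
  (Nat.beq (lk c (Nat.shiftRight e (nat_lit 3)))
    (Nat.add (Nat.mul (nat_lit 8) i) (lk (nat_lit 5420097600) (Nat.land e (nat_lit 7)))))

/-- Validity of the digit at position `i`. -/
def validAt (c i : ℕ) : Bool := validEnt c i (lk c i)

/-- Validity of a code. -/
def validPos (c : ℕ) : Bool :=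
  (Nat.blt c (nat_lit 281474976710656)).and (
  (validAt c (nat_lit 0)).and ((validAt c (nat_lit 1)).and ((validAt c (nat_lit 2)).and ((validAt c (nat_lit 3)).and ((validAt c (nat_lit 4)).and ((validAt c (nat_lit 5)).and ((validAt c (nat_lit 6)).and (validAt c (nat_lit 7)))))))))

/-- Validity of a nonzero code; the matching forces the evaluation. -/
def valid : ℕ → Bool
  | Nat.zero => false
  | Nat.succ c => validPos (Nat.succ c)

theorem okMask_spec : ∀ i < 8, ∀ e < 64,
    Nat.land (Nat.shiftRight okMask (Nat.add (Nat.mul 64 i) e)) 1 = 1 →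
      e / 8 ≠ i ∧ e % 8 ∈ choices i (e / 8) := by
  decide +kernel

theorem choices_lt (F G p : ℕ) (h : p ∈ choices F G) : p < 6 := by
  unfold choices at h
  cases hx : xor (oddFace F) (oddFace G) <;> rw [hx] at h <;> simp at h <;> omega

theorem inv_spec : ∀ p < 6, lk 5420097600 p = invIdx p := by
  decide +kernel

theorem validAt_spec {c i : ℕ} (hi : i < 8) (h : validAt c i = true) :
    (lk c i / 8 ≠ i ∧ lk c (lk c i / 8) = 8 * i + invIdx (lk c i % 8)) ∧
      lk c i % 8 ∈ choices i (lk c i / 8) := by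
  have hlt := lk_lt c i
  unfold validAt at h
  generalize lk c i = e at h hlt ⊢
  simp only [validEnt, Bool.and_eq_true, Nat.beq_eq] at h
  obtain ⟨h1, h2⟩ := h
  obtain ⟨h3, h4⟩ := okMask_spec i hi e hlt h1
  refine ⟨⟨h3, ?_⟩, h4⟩
  change lk c (e >>> 3) = 8 * i + lk 5420097600 (e &&& 7) at h2
  rw [Nat.shiftRight_eq_div_pow, show (7 : ℕ) = 2 ^ 3 - 1 from rfl,
    Nat.and_two_pow_sub_one_eq_mod] at h2
  norm_num at h2
  rw [h2, inv_spec _ (choices_lt _ _ _ h4)]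

theorem valid_spec {c : ℕ} (h : valid c = true) :
    c < 64 ^ 8 ∧ ∀ i < 8, validAt c i = true := by
  cases c with
  | zero => exact absurd h (by decide)
  | succ c =>
    change validPos (c + 1) = true at h
    simp only [validPos, Bool.and_eq_true, Nat.blt_eq] at h
    obtain ⟨hl, h0, h1, h2, h3, h4, h5, h6, h7⟩ := h
    refine ⟨hl, fun i hi => ?_⟩
    interval_cases i <;> assumption

/-- Strictly decreasing lists. -/
def isDesc : List ℕ → Bool
  | [] => true
  | [_] => true
  | a :: b :: l => Nat.blt b a && isDesc (b :: l)

set_option maxRecDepth 100000 in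
theorem branches_ok : (tops.all fun t => isDesc (branch t.1 t.2) &&
    (branch t.1 t.2).all fun c => (valid c).and (Nat.beq (lk c 7) (8 * t.1 + t.2))) = true := by
  decide +kernel

theorem isDesc_nodup : ∀ l, isDesc l = true → l.Nodup := by
  intro l h
  have : l.IsChain (· > ·) := by
    induction l with
    | nil => simp
    | cons a l ih =>
      cases l with
      | nil => simp
      | cons b l =>
        simp only [isDesc, Bool.and_eq_true, Nat.blt_eq] at h
        exact List.isChain_cons_cons.2 ⟨h.1, ih h.2⟩
  exact (List.isChain_iff_pairwise.1 this).imp (fun h => (ne_of_lt h).symm)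

theorem branch_facts {t : ℕ × ℕ} (ht : t ∈ tops) : (branch t.1 t.2).Nodup ∧
    ∀ c ∈ branch t.1 t.2, valid c = true ∧ lk c 7 = 8 * t.1 + t.2 := by
  have h := List.all_eq_true.1 branches_ok t ht
  simp only [Bool.and_eq_true, List.all_eq_true, Nat.beq_eq] at h
  exact ⟨isDesc_nodup _ h.1, h.2⟩

theorem allCodes_valid {c : ℕ} (hc : c ∈ allCodes) : valid c = true := by
  rw [allCodes_eq, List.mem_flatMap] at hc
  obtain ⟨t, ht, hc⟩ := hc
  exact ((branch_facts ht).2 c hc).1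

theorem tops_pairwise : tops.Pairwise fun s t => 8 * s.1 + s.2 ≠ 8 * t.1 + t.2 := by
  decide +kernel

theorem allCodes_nodup : allCodes.Nodup := by
  rw [allCodes_eq, List.nodup_flatMap]
  refine ⟨fun t ht => (branch_facts ht).1, ?_⟩
  refine tops_pairwise.imp_of_mem ?_
  intro s t hs ht hst c hc1 hc2
  exact hst (((branch_facts hs).2 c hc1).2.symm.trans ((branch_facts ht).2 c hc2).2)

theorem sumF_eq (l : List ℕ) : sumF l = (l.map fixNum).sum := by
  induction l with
  | nil => rfl
  | cons c l ih =>
    rw [List.map_cons, List.sum_cons, ← ih]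
    cases c <;> rfl

theorem sum_fixNum : (allCodes.map fixNum).sum = 14304 := by
  rw [← sum_branches, allCodes_eq]
  induction tops with
  | nil => rfl
  | cons t l ih => simp [sumF_eq, ih]

/-! ### Codes of gluings -/

/-- Index of a face. -/
def fi (F : OctFace) : ℕ := 4 * (F 0).toNat + 2 * (F 1).toNat + (F 2).toNat

/-- Face with a given index. -/
def fj (i : ℕ) : OctFace := ![i.testBit 2, i.testBit 1, i.testBit 0]

/-- Index of an axis permutation. -/
def pidx (p : Equiv.Perm (Fin 3)) : ℕ := 2 * (p 0).val + (if p 1 < p 2 then 0 else 1)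

/-- Code of a face together with an axis permutation. -/
def ent (F : OctFace) (p : Equiv.Perm (Fin 3)) : ℕ := 8 * fi F + pidx p

theorem fj_fi : ∀ F, fj (fi F) = F := by decide +kernel
theorem fi_lt : ∀ F, fi F < 8 := by decide +kernel
theorem fi_fj : ∀ i < 8, fi (fj i) = i := by decide +kernel
theorem pidx_lt : ∀ p, pidx p < 6 := by decide +kernel
theorem pidx_surj : ∀ i < 6, ∃ p, pidx p = i := by decide +kernel
theorem pidx_inj : ∀ p q, pidx p = pidx q → p = q := by decide +kernel
theorem invIdx_pidx : ∀ p, invIdx (pidx p) = pidx p⁻¹ := by decide +kernel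
theorem choices_iff : ∀ F G p, (Equiv.Perm.sign p = 1 ↔ faceSign F ≠ faceSign G) ↔
    pidx p ∈ choices (fi F) (fi G) := by decide +kernel
theorem fi_inj {F G : OctFace} (h : fi F = fi G) : F = G := by
  rw [← fj_fi F, h, fj_fi]

theorem ent_inj {F G p q} (h : ent F p = ent G q) : F = G ∧ p = q := by
  have := pidx_lt p
  have := pidx_lt q
  unfold ent at h
  exact ⟨fi_inj (by omega), pidx_inj _ _ (by omega)⟩

theorem ent_lt (F p) : ent F p < 64 := by
  have := pidx_lt p
  have := fi_lt F
  unfold ent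
  omega

/-- Table of an axis permutation. -/
def tab (ρ : Equiv.Perm (Fin 3)) : ℕ := tabs.getD (pidx ρ) 0

set_option maxRecDepth 100000 in
theorem tab_face : ∀ ρ ε F, Nat.shiftRight (lk (tab ρ)
    (Nat.shiftLeft (Nat.xor (fi F) (fi ε)) (nat_lit 3))) (nat_lit 3) = fi (symMapFace ρ ε F) := by
  decide +kernel

set_option maxRecDepth 100000 in
theorem tab_ent : ∀ ρ ε F p, lk (tab ρ) (Nat.xor (ent F p) (Nat.shiftLeft (fi ε) (nat_lit 3))) =
    ent (symMapFace ρ ε F) (ρ * p * ρ⁻¹) := by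
  decide +kernel

/-- Digit of the code of a gluing. -/
def dg (g : Gluing) (i : ℕ) : ℕ := ent (g.face (fj i)) (g.axisMap (fj i))

/-- The code of a gluing. -/
def code (g : Gluing) : ℕ := ([7, 6, 5, 4, 3, 2, 1, 0].map fun i => 64 ^ i * dg g i).sum

theorem lk_sum (d : ℕ → ℕ) (hd : ∀ i, d i < 64) (i : ℕ) (hi : i < 8) :
    lk ([7, 6, 5, 4, 3, 2, 1, 0].map fun i => 64 ^ i * d i).sum i = d i := by
  rw [lk_eq]
  have h0 := hd 0
  have h1 := hd 1
  have h2 := hd 2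
  have h3 := hd 3
  have h4 := hd 4
  have h5 := hd 5
  have h6 := hd 6
  have h7 := hd 7
  simp only [List.map_cons, List.map_nil, List.sum_cons, List.sum_nil]
  interval_cases i <;> norm_num <;> omega

theorem lk_code (g : Gluing) (F : OctFace) :
    lk (code g) (fi F) = ent (g.face F) (g.axisMap F) := by
  rw [code, lk_sum (dg g) (fun i => ent_lt _ _) _ (fi_lt F), dg, fj_fi]

theorem code_inj : Function.Injective code := by
  intro g h e
  have key : ∀ F, ent (g.face F) (g.axisMap F) = ent (h.face F) (h.axisMap F) := fun F => by
    rw [← lk_code, e, lk_code]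
  exact Sym.gluing_ext (Equiv.ext fun F => (ent_inj (key F)).1) fun F => (ent_inj (key F)).2

theorem eq_sum (c : ℕ) (hc : c < 64 ^ 8) :
    c = ([7, 6, 5, 4, 3, 2, 1, 0].map fun i => 64 ^ i * lk c i).sum := by
  simp only [List.map_cons, List.map_nil, List.sum_cons, List.sum_nil, lk_eq]
  norm_num at hc ⊢
  omega

/-! ### Completeness and soundness of the enumeration -/

theorem mem_enumCodes (g : Gluing) : ∀ (n : ℕ) (U : List ℕ), U.length ≤ 2 * n → U.Nodup →
    (∀ i ∈ U, i < 8) → (∀ i ∈ U, fi (g.face (fj i)) ∈ U) →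
    (U.map fun i => 64 ^ i * dg g i).sum ∈ enumCodes n U := by
  obtain ⟨h1, h2, h3, h4⟩ := g.2
  change ∀ F, g.face (g.face F) = F at h1
  change ∀ F, g.face F ≠ F at h2
  change ∀ F, g.axisMap (g.face F) = (g.axisMap F)⁻¹ at h3
  change ∀ F, Equiv.Perm.sign (g.axisMap F) = 1 ↔ faceSign F ≠ faceSign (g.face F) at h4
  intro n
  induction n with
  | zero =>
    intro U hU
    have : U = [] := List.length_eq_zero_iff.1 (by omega)
    subst this
    simp [enumCodes]
  | succ n ih =>
    intro U hU hnd hlt hcl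
    cases U with
    | nil => simp [enumCodes]
    | cons F rest =>
      have hF : F < 8 := hlt F (by simp)
      set G := fi (g.face (fj F)) with hG
      have hfG : fj G = g.face (fj F) := fj_fi _
      have hGF : G ≠ F := by
        intro h
        apply h2 (fj F)
        rw [← hfG, h]
      have hGr : G ∈ rest := by
        have := hcl F (by simp)
        simpa [← hG, hGF] using this
      rw [List.nodup_cons] at hnd
      simp only [enumCodes, List.mem_flatMap, List.mem_map]
      refine ⟨G, hGr, pidx (g.axisMap (fj F)), ?_,
        ((rest.erase G).map fun i => 64 ^ i * dg g i).sum, ?_, ?_⟩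
      · have := (choices_iff (fj F) (g.face (fj F)) (g.axisMap (fj F))).1 (h4 (fj F))
        rwa [fi_fj F hF] at this
      · apply ih
        · rw [List.length_erase_of_mem hGr]
          simp only [List.length_cons] at hU
          omega
        · exact hnd.2.erase G
        · intro i hi
          exact hlt i (List.mem_cons_of_mem _ (List.mem_of_mem_erase hi))
        · intro i hi
          rw [hnd.2.mem_erase_iff] at hi
          have hi8 : i < 8 := hlt i (List.mem_cons_of_mem _ hi.2)
          rw [hnd.2.mem_erase_iff]
          have hne : fi (g.face (fj i)) ≠ F := by
            intro h
            apply hi.1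
            rw [hG, ← h, fj_fi, h1, fi_fj i hi8]
          refine ⟨?_, ?_⟩
          · intro h
            have h' := fi_inj (h.trans hG)
            have h'' := g.face.injective h'
            have : i = F := by rw [← fi_fj i hi8, h'', fi_fj F hF]
            exact hnd.1 (this ▸ hi.2)
          · have := hcl i (List.mem_cons_of_mem _ hi.2)
            simpa [hne] using this
      · have e1 : dg g F = 8 * G + pidx (g.axisMap (fj F)) := rfl
        have e2 : dg g G = 8 * F + invIdx (pidx (g.axisMap (fj F))) := by
          rw [dg, hfG, h1, h3, ent, fi_fj F hF, invIdx_pidx]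
        rw [List.map_cons, List.sum_cons, ← List.sum_map_erase _ hGr, pairCode, ← e1, ← e2]
        ring

theorem code_mem (g : Gluing) : code g ∈ allCodes := by
  refine mem_enumCodes g 4 _ (by simp) (by decide) (by decide) ?_
  intro i _
  have := fi_lt (g.face (fj i))
  generalize fi (g.face (fj i)) = x at this
  interval_cases x <;> simp

theorem exists_code {c : ℕ} (hc : valid c = true) : ∃ g, code g = c := by
  obtain ⟨hlt, hv'⟩ := valid_spec hc
  have hv := fun F : OctFace => validAt_spec (fi_lt F) (hv' _ (fi_lt F))
  have hex : ∀ F : OctFace, ∃ Gp : OctFace × Equiv.Perm (Fin 3), lk c (fi F) = ent Gp.1 Gp.2 := by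
    intro F
    obtain ⟨p, hp⟩ := pidx_surj _ (choices_lt _ _ _ (hv F).2)
    refine ⟨(fj (lk c (fi F) / 8), p), ?_⟩
    have := lk_lt c (fi F)
    rw [ent, fi_fj _ (by omega), hp]
    omega
  choose f hf using hex
  have hd : ∀ F, lk c (fi F) / 8 = fi (f F).1 := fun F => by
    have := pidx_lt (f F).2
    rw [hf, ent]; omega
  have hm : ∀ F, lk c (fi F) % 8 = pidx (f F).2 := fun F => by
    have := pidx_lt (f F).2
    rw [hf, ent]; omega
  simp only [hd, hm] at hv
  have hinv : ∀ F, (f (f F).1).1 = F ∧ (f (f F).1).2 = (f F).2⁻¹ := by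
    intro F
    have h := (hv F).1.2
    rw [hf, invIdx_pidx] at h
    exact ent_inj (h.trans rfl)
  let σ : Equiv.Perm OctFace :=
    ⟨fun F => (f F).1, fun F => (f F).1, fun F => (hinv F).1, fun F => (hinv F).1⟩
  refine ⟨⟨(σ, fun F => (f F).2), fun F => (hinv F).1, fun F h => (hv F).1.1 ?_,
    fun F => (hinv F).2, fun F => (choices_iff _ _ _).2 (hv F).2⟩, ?_⟩
  · exact congrArg fi h
  · refine Eq.trans ?_ (eq_sum c hlt).symm
    rw [code]
    congr 1
    apply List.map_congr_left
    intro i hi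
    have hi8 : i < 8 := by
      revert i; decide
    congr 1
    conv_rhs => rw [← fi_fj i hi8, hf]
    rfl

/-! ### Counting fixed points -/

theorem check_iff (a : Sym) (g : Gluing) :
    check (tab a.ρ) (fi a.ε) (code g) = true ↔ a • g = g := by
  have key : ∀ F, checkAt (tab a.ρ) (fi a.ε) (code g) (fi F) = true ↔
      (g.face (symMapFace a.ρ a.ε F) = symMapFace a.ρ a.ε (g.face F)) ∧
      (g.axisMap (symMapFace a.ρ a.ε F) = a.ρ * g.axisMap F * a.ρ⁻¹) := by
    intro F
    rw [checkAt, Nat.beq_eq, tab_face, lk_code, lk_code, tab_ent]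
    constructor
    · exact ent_inj
    · rintro ⟨h1, h2⟩
      rw [h1, h2]
  rw [Sym.smul_eq_iff, ← forall_and]
  simp only [← key]
  constructor
  · intro h F
    simp only [check, Bool.and_eq_true] at h
    obtain ⟨h0, h1, h2, h3, h4, h5, h6, h7⟩ := h
    have := fi_lt F
    generalize fi F = x at this
    interval_cases x <;> assumption
  · intro h
    simp only [check, Bool.and_eq_true]
    exact ⟨h (fj 0), h (fj 1), h (fj 2), h (fj 3), h (fj 4), h (fj 5), h (fj 6), h (fj 7)⟩

theorem card_fixed (a : Sym) : Nat.card (MulAction.fixedBy Gluing a) =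
    (allCodes.filter (check (tab a.ρ) (fi a.ε))).length := by
  have h : code '' (MulAction.fixedBy Gluing a) =
      ((allCodes.filter (check (tab a.ρ) (fi a.ε))).toFinset : Set ℕ) := by
    ext c
    simp only [Set.mem_image, MulAction.mem_fixedBy, Finset.mem_coe, List.mem_toFinset,
      List.mem_filter]
    constructor
    · rintro ⟨g, hg, rfl⟩
      exact ⟨code_mem g, (check_iff a g).2 hg⟩
    · rintro ⟨hc, hc'⟩
      obtain ⟨g, rfl⟩ := exists_code (allCodes_valid hc)
      exact ⟨g, (check_iff a g).1 hc', rfl⟩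
  rw [← Nat.card_image_of_injective code_inj, h, ← List.toFinset_card_of_nodup
    (allCodes_nodup.filter _), Nat.card_coe_set_eq, Set.ncard_coe_finset]

/-- Representatives of the conjugacy classes. -/
def rep (i : ℕ) : Sym :=
  [⟨1, fj 0⟩, ⟨1, fj 1⟩, ⟨1, fj 3⟩, ⟨1, fj 7⟩, ⟨Equiv.swap 1 2, fj 0⟩, ⟨Equiv.swap 1 2, fj 1⟩,
    ⟨Equiv.swap 1 2, fj 4⟩, ⟨Equiv.swap 1 2, fj 5⟩, ⟨finRotate 3, fj 0⟩,
    (⟨finRotate 3, fj 1⟩ : Sym)].getD i 1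

/-- Number of the conjugacy class of a symmetry. -/
def cls (a : Sym) : ℕ :=
  [0, 1, 1, 2, 1, 2, 2, 3, 4, 5, 5, 4, 6, 7, 7, 6, 4, 6, 5, 7, 5, 7, 4, 6, 8, 9, 9, 8, 9, 8, 8, 9, 8, 9, 9, 8, 9, 8, 8, 9, 4, 5, 6, 7, 5, 4, 7, 6].getD
    (8 * pidx a.ρ + fi a.ε) 0

theorem cls_conj' : ∀ (ρ : Equiv.Perm (Fin 3)) (ε : OctFace),
    ∃ (ρ' : Equiv.Perm (Fin 3)) (ε' : OctFace),
      ρ' * ρ = (rep (cls ⟨ρ, ε⟩)).ρ * ρ' ∧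
      ∀ i, Bool.xor (ε i) (ε' (ρ i)) = Bool.xor (ε' i) ((rep (cls ⟨ρ, ε⟩)).ε (ρ' i)) := by
  decide +kernel

theorem cls_conj (a : Sym) : ∃ h : Sym, h * a = rep (cls a) * h := by
  obtain ⟨ρ', ε', h1, h2⟩ := cls_conj' a.ρ a.ε
  exact ⟨⟨ρ', ε'⟩, Sym.ext h1 (funext h2)⟩

theorem card_fixed_conj (a b h : Sym) (e : h * a = b * h) :
    Nat.card (MulAction.fixedBy Gluing a) = Nat.card (MulAction.fixedBy Gluing b) := by
  have hb : b = h * a * h⁻¹ := by rw [e]; simp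
  refine Nat.card_congr ((MulAction.toPerm h).subtypeEquiv ?_)
  intro g
  change a • g = g ↔ b • h • g = h • g
  rw [← mul_smul, ← e, mul_smul]
  exact (MulAction.injective h).eq_iff.symm

theorem sum_cls (f : ℕ → ℕ) : ∑ a : Sym, f (cls a) =
    f 0 + 3 * f 1 + 3 * f 2 + f 3 + 6 * f 4 + 6 * f 5 + 6 * f 6 + 6 * f 7 + 8 * f 8 + 8 * f 9 := by
  have h := Fintype.sum_equiv Sym.equivProd (fun a : Sym => f (cls a))
    (fun q : Equiv.Perm (Fin 3) × OctFace => f (cls ⟨q.1, q.2⟩)) (fun _ => rfl)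
  rw [h, Finset.sum_comp f (fun q : Equiv.Perm (Fin 3) × OctFace => cls ⟨q.1, q.2⟩)]
  have himg : (Finset.univ : Finset (Equiv.Perm (Fin 3) × OctFace)).image
      (fun q => cls ⟨q.1, q.2⟩) = Finset.range 10 := by decide +kernel
  have hcard : ∀ i < 10, (Finset.univ.filter
      (fun q : Equiv.Perm (Fin 3) × OctFace => cls ⟨q.1, q.2⟩ = i)).card =
      [1, 3, 3, 1, 6, 6, 6, 6, 8, 8].getD i 0 := by decide +kernel
  rw [himg, Finset.sum_congr rfl (g := fun i => [1, 3, 3, 1, 6, 6, 6, 6, 8, 8].getD i 0 * f i)]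
  · simp [Finset.sum_range_succ]
  · intro i hi
    rw [hcard i (Finset.mem_range.1 hi), smul_eq_mul]

theorem length_filter_eq (P : ℕ → Bool) (l : List ℕ) :
    (l.filter P).length = (l.map fun c => bif P c then 1 else 0).sum := by
  induction l with
  | nil => rfl
  | cons a l ih =>
    cases h : P a <;> simp [h, ih, add_comm]

theorem sum_fixed : ∑ a : Sym, Nat.card (MulAction.fixedBy Gluing a) = 14304 := by
  rw [← sum_fixNum]
  have h : ∀ a : Sym, Nat.card (MulAction.fixedBy Gluing a) =
      Nat.card (MulAction.fixedBy Gluing (rep (cls a))) := fun a => by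
    obtain ⟨h, e⟩ := cls_conj a
    exact card_fixed_conj _ _ h e
  rw [Finset.sum_congr rfl (fun a _ => h a)]
  rw [sum_cls (fun i => Nat.card (MulAction.fixedBy Gluing (rep i)))]
  have h0 : Nat.card (MulAction.fixedBy Gluing (rep 0)) = allCodes.length := by
    rw [card_fixed, List.filter_eq_self.2]
    intro c hc
    obtain ⟨g, rfl⟩ := exists_code (allCodes_valid hc)
    rw [check_iff]
    have : rep 0 = 1 := Sym.ext rfl (by decide)
    rw [this, one_smul]
  have hr : ∀ i (k m : ℕ), tab (rep i).ρ = k → fi (rep i).ε = m →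
      Nat.card (MulAction.fixedBy Gluing (rep i)) =
        (allCodes.map fun c => cond (check k m c) 1 0).sum := by
    rintro i _ _ rfl rfl
    rw [card_fixed, length_filter_eq]
  rw [h0,
    hr 1 tab0 1 (by decide +kernel) (by decide +kernel),
    hr 2 tab0 3 (by decide +kernel) (by decide +kernel),
    hr 3 tab0 7 (by decide +kernel) (by decide +kernel),
    hr 4 tab1 0 (by decide +kernel) (by decide +kernel),
    hr 5 tab1 1 (by decide +kernel) (by decide +kernel),
    hr 6 tab1 4 (by decide +kernel) (by decide +kernel),
    hr 7 tab1 5 (by decide +kernel) (by decide +kernel),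
    hr 8 tab3 0 (by decide +kernel) (by decide +kernel),
    hr 9 tab3 1 (by decide +kernel) (by decide +kernel)]
  have hfix : ∀ c, fixNum c =
      1 + 3 * cond (check tab0 1 c) 1 0 + 3 * cond (check tab0 3 c) 1 0 + cond (check tab0 7 c) 1 0
        + 6 * cond (check tab1 0 c) 1 0
        + 6 * cond (check tab1 1 c) 1 0
        + 6 * cond (check tab1 4 c) 1 0
        + 6 * cond (check tab1 5 c) 1 0 + 8 * cond (check tab3 0 c) 1 0 + 8 * cond (check tab3 1 c) 1 0 := by
    intro c
    have hw : ∀ (b : Bool) (k : ℕ), cond b k 0 = k * cond b 1 0 := by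
      intro b k; cases b <;> simp
    have : fixNum c = 1 + (cond (check tab0 1 c) 3 0 + (cond (check tab0 3 c) 3 0 + (cond (check tab0 7 c) 1 0 + (cond (check tab1 0 c) 6 0 + (cond (check tab1 1 c) 6 0 + (cond (check tab1 4 c) 6 0 + (cond (check tab1 5 c) 6 0 + (cond (check tab3 0 c) 8 0 + (cond (check tab3 1 c) 8 0))))))))) := rfl
    rw [this]
    simp only [fun b => hw b 3, fun b => hw b 6, fun b => hw b 8]
    ring
  induction allCodes with
  | nil => simp
  | cons c l ih =>
    simp only [List.map_cons, List.sum_cons, List.length_cons, ← ih, hfix]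
    ring

theorem burnside : Nat.card (Quotient (MulAction.orbitRel Sym Gluing)) = 298 := by
  classical
  have h := MulAction.sum_card_fixedBy_eq_card_orbits_mul_card_group Sym Gluing
  have h' := sum_fixed
  simp only [Nat.card_eq_fintype_card] at h' ⊢
  rw [h', Sym.card_eq] at h
  have h48 : 48 * 298 = 14304 := by norm_num
  omega

end OctCount

/-- There are exactly `298` orbits of orientation-reversing gluing patterns
of the faces of the octahedron under the action of the symmetry group of the octahedron,
i.e. exactly `298` combinatorially inequivalent orientation-reversing gluing patterns. -/
theorem count_inequivalent_gluing_patterns :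
    Nat.card {s : Set Gluing // ∃ g : Gluing, s = orbit g} = 298 := by
  rw [OctCount.card_orbits, OctCount.burnside]
end

section
/- For every orientation-reversing gluing pattern φ of the faces of the octahedron, the sum over all vertex classes of the Euler characteristics of the corresponding link surfaces equals 2e − 6, where e is the number of edge classes of φ. -/
namespace OctaProof

/-- Reversal of an edge-end. -/
def rev (p : EdgeEnd) : EdgeEnd := ⟨(p.1.2, p.1.1), p.2.symm⟩

theorem rev_rev (p : EdgeEnd) : rev (rev p) = p := rfl

theorem rev_ne (p : EdgeEnd) : rev p ≠ p := by
  intro h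
  have h1 : (rev p).1.1.1 = p.1.1.1 := by rw [h]
  exact p.2 h1.symm

/-- The edge-end of the face `F` from axis `i` to axis `j`. -/
def mk (F : OctFace) (i j : Fin 3) (h : i ≠ j) : EdgeEnd := ⟨((i, F i), (j, F j)), h⟩

/-- The face on a fixed side of an oriented edge. -/
def side (p : EdgeEnd) : OctFace := fun x =>
  if x = p.1.1.1 then p.1.1.2 else if x = p.1.2.1 then p.1.2.2 else
    Bool.xor (decide (p.1.2.1 = p.1.1.1 + 1)) (Bool.xor p.1.1.2 p.1.2.2)

theorem side_fst (p : EdgeEnd) : side p p.1.1.1 = p.1.1.2 := by simp [side]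

theorem side_snd (p : EdgeEnd) : side p p.1.2.1 = p.1.2.2 := by simp [side, p.2.symm]

theorem mk_side (p : EdgeEnd) : mk (side p) p.1.1.1 p.1.2.1 p.2 = p := by
  apply Subtype.ext
  simp [mk, side_fst, side_snd]

theorem faceSign_side : ∀ p : EdgeEnd,
    faceSign (side p) = decide (p.1.2.1 = p.1.1.1 + 1) := by
  decide

theorem side_mk : ∀ (F : OctFace) (i j : Fin 3) (h : i ≠ j),
    faceSign F = decide (j = i + 1) → side (mk F i j h) = F := by
  decide

theorem succ_swap : ∀ i j : Fin 3, i ≠ j → decide (i = j + 1) = !decide (j = i + 1) := by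
  decide

theorem sign_iff : ∀ (τ : Equiv.Perm (Fin 3)) (i j : Fin 3), i ≠ j →
    (Equiv.Perm.sign τ = 1 ↔ decide (τ i = τ j + 1) ≠ decide (j = i + 1)) := by
  decide

variable (g : Gluing)

theorem face_face (F) : g.face (g.face F) = F := g.2.1 F
theorem face_ne (F) : g.face F ≠ F := g.2.2.1 F
theorem axis_face (F) : g.axisMap (g.face F) = (g.axisMap F)⁻¹ := g.2.2.2.1 F
theorem sign_axis (F) : Equiv.Perm.sign (g.axisMap F) = 1 ↔ faceSign F ≠ faceSign (g.face F) :=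
  g.2.2.2.2 F

/-- Glue across the face `side p`. -/
def step (p : EdgeEnd) : EdgeEnd :=
  mk (g.face (side p)) (g.axisMap (side p) p.1.1.1) (g.axisMap (side p) p.1.2.1)
    (fun h => p.2 ((g.axisMap (side p)).injective h))

theorem endRel_step (p : EdgeEnd) : endRel g p (step g p) :=
  ⟨side p, p.1.1.1, p.1.2.1, p.2, congrArg Subtype.val (mk_side p).symm, rfl⟩

theorem side_rev_step (p : EdgeEnd) : side (rev (step g p)) = g.face (side p) := by
  have hne : g.axisMap (side p) p.1.2.1 ≠ g.axisMap (side p) p.1.1.1 :=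
    fun h => p.2 ((g.axisMap (side p)).injective h.symm)
  have h := side_mk (g.face (side p)) (g.axisMap (side p) p.1.2.1)
    (g.axisMap (side p) p.1.1.1) hne
  apply h
  have h1 := sign_iff (g.axisMap (side p)) _ _ p.2
  rw [sign_axis, faceSign_side] at h1
  revert h1
  generalize decide (p.1.2.1 = p.1.1.1 + 1) = a
  generalize faceSign (g.face (side p)) = b
  generalize decide (g.axisMap (side p) p.1.1.1 = g.axisMap (side p) p.1.2.1 + 1) = c
  revert a b c
  decide

theorem step_rev_step (p : EdgeEnd) : step g (rev (step g p)) = rev p := by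
  apply Subtype.ext
  have h := side_rev_step g p
  simp only [step, mk] at h ⊢
  simp only [h, face_face, axis_face]
  simp [rev, side_fst, side_snd]

/-- `step` as a permutation. -/
def T : Equiv.Perm EdgeEnd where
  toFun := step g
  invFun p := rev (step g (rev p))
  left_inv p := by dsimp only; rw [step_rev_step, rev_rev]
  right_inv p := by dsimp only; rw [step_rev_step, rev_rev]

theorem rev_T (p : EdgeEnd) : rev (T g p) = (T g)⁻¹ (rev p) := rfl

theorem rev_T_inv (p : EdgeEnd) : rev ((T g)⁻¹ p) = T g (rev p) := rfl

theorem rev_zpow (k : ℤ) (p : EdgeEnd) : rev (((T g) ^ k) p) = ((T g) ^ (-k)) (rev p) := by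
  induction k generalizing p with
  | zero => rfl
  | succ n ih =>
    rw [zpow_add_one, Equiv.Perm.mul_apply, ih, rev_T, neg_add, zpow_add, zpow_neg_one,
      Equiv.Perm.mul_apply]
  | pred n ih =>
    rw [zpow_sub_one, Equiv.Perm.mul_apply, ih, rev_T_inv, neg_sub, sub_eq_add_neg, add_comm,
      zpow_add, zpow_one, Equiv.Perm.mul_apply]

theorem rev_ne_T (p : EdgeEnd) : rev p ≠ T g p := by
  intro h
  have h1 : side (rev (T g p)) = g.face (side p) := side_rev_step g p
  rw [← h, rev_rev] at h1
  exact face_ne g _ h1.symm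

theorem not_sameCycle_rev (p : EdgeEnd) : ¬ (T g).SameCycle p (rev p) := by
  rintro ⟨k, hk⟩
  obtain ⟨m, rfl | rfl⟩ := Int.even_or_odd' k
  · apply rev_ne (((T g) ^ m) p)
    rw [rev_zpow, ← hk, ← Equiv.Perm.mul_apply, ← zpow_add]
    congr 2; ring
  · apply rev_ne_T g (((T g) ^ m) p)
    rw [rev_zpow, ← hk, ← Equiv.Perm.mul_apply, ← zpow_add, ← Equiv.Perm.mul_apply,
      ← zpow_one_add]
    congr 2; ring

theorem sameCycle_rev {p q : EdgeEnd} (h : (T g).SameCycle p q) :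
    (T g).SameCycle (rev p) (rev q) := by
  obtain ⟨k, rfl⟩ := h
  exact ⟨-k, (rev_zpow g k p).symm⟩

theorem step_mk (F i j) (h : i ≠ j) (hs : faceSign F = decide (j = i + 1)) :
    step g (mk F i j h) = mk (g.face F) (g.axisMap F i) (g.axisMap F j)
      (fun e => h ((g.axisMap F).injective e)) := by
  apply Subtype.ext
  have := side_mk F i j h hs
  simp only [step, this]
  rfl

theorem sameCycle_of_endRel {p q : EdgeEnd} (h : endRel g p q) : (T g).SameCycle p q := by
  obtain ⟨F, i, j, hij, hp, hq⟩ := h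
  obtain rfl : p = mk F i j hij := Subtype.ext hp
  obtain rfl : q = mk (g.face F) (g.axisMap F i) (g.axisMap F j)
      (fun e => hij ((g.axisMap F).injective e)) := Subtype.ext hq
  by_cases hs : faceSign F = decide (j = i + 1)
  · exact ⟨1, by rw [zpow_one]; exact step_mk g F i j hij hs⟩
  · have hs' : faceSign F = decide (i = j + 1) := by
      rw [succ_swap i j hij]
      revert hs
      generalize faceSign F = a
      generalize decide (j = i + 1) = b
      revert a b
      decide
    have := sameCycle_rev g (p := mk F j i hij.symm) ⟨1, rfl⟩
    rw [zpow_one] at this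
    have e : T g (mk F j i hij.symm) = _ := step_mk g F j i hij.symm hs'
    rw [e] at this
    exact this

theorem end_iff (p q : EdgeEnd) : (endSetoid g).r p q ↔ (T g).SameCycle p q := by
  constructor
  · intro h
    change Relation.EqvGen (endRel g) p q at h
    induction h with
    | rel _ _ h => exact sameCycle_of_endRel g h
    | refl _ => exact Equiv.Perm.SameCycle.refl _ _
    | symm _ _ _ ih => exact ih.symm
    | trans _ _ _ _ _ h1 h2 => exact h1.trans h2
  · rintro ⟨k, rfl⟩
    induction k with
    | zero => exact (endSetoid g).refl _
    | succ n ih =>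
      refine (endSetoid g).trans ih ?_
      rw [add_comm, zpow_one_add]
      exact Relation.EqvGen.rel _ _ (endRel_step g _)
    | pred n ih =>
      refine (endSetoid g).trans ih ?_
      rw [sub_eq_add_neg, add_comm, zpow_add, zpow_neg_one, Equiv.Perm.mul_apply]
      apply (endSetoid g).symm
      have := Relation.EqvGen.rel _ _ (endRel_step g ((T g)⁻¹ (((T g) ^ (-(n : ℤ))) p)))
      have e : step g ((T g)⁻¹ (((T g) ^ (-(n : ℤ))) p)) = (((T g) ^ (-(n : ℤ))) p) :=
        (T g).apply_symm_apply _
      rw [e] at this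
      exact this

theorem edge_iff (p q : EdgeEnd) :
    (edgeSetoid g).r p q ↔ (T g).SameCycle p q ∨ (T g).SameCycle (rev p) q := by
  constructor
  · intro h
    change Relation.EqvGen (edgeRel g) p q at h
    induction h with
    | rel _ _ h =>
      rcases h with h | h
      · exact Or.inl (sameCycle_of_endRel g h)
      · exact Or.inr ⟨0, Subtype.ext h.symm⟩
    | refl _ => exact Or.inl (Equiv.Perm.SameCycle.refl _ _)
    | symm _ _ _ ih => exact ih.imp (fun h => h.symm) (fun h => (sameCycle_rev g h).symm)
    | trans _ _ _ _ _ h1 h2 =>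
      rcases h1 with h1 | h1 <;> rcases h2 with h2 | h2
      · exact Or.inl (h1.trans h2)
      · exact Or.inr ((sameCycle_rev g h1).trans h2)
      · exact Or.inr (h1.trans h2)
      · exact Or.inl ((sameCycle_rev g h1).trans h2)
  · have key : ∀ a b, (T g).SameCycle a b → (edgeSetoid g).r a b := by
      intro a b h
      rw [← end_iff] at h
      exact Relation.EqvGen.mono (r := endRel g) (fun _ _ h => Or.inl h) _ _ h
    rintro (h | h)
    · exact key _ _ h
    · exact (edgeSetoid g).trans (Relation.EqvGen.rel p (rev p) (Or.inr rfl)) (key _ _ h)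

/-- The forgetful map from end classes to edge classes. -/
def forget : Quotient (endSetoid g) → Quotient (edgeSetoid g) :=
  Quotient.map' id (fun p q h => (edge_iff g p q).2 (Or.inl ((end_iff g p q).1 h)))

theorem card_sum_fibers {α β : Type*} [Finite α] [Fintype β] (f : α → β) :
    ∑ b, Nat.card {a // f a = b} = Nat.card α := by
  rw [← Nat.card_sigma]
  exact Nat.card_congr (Equiv.sigmaFiberEquiv f)

theorem fiber_card (c : Quotient (edgeSetoid g)) : Nat.card {q // forget g q = c} = 2 := by
  induction c using Quotient.inductionOn with
  | h p =>
  have : {q | forget g q = Quotient.mk _ p} =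
      {Quotient.mk (endSetoid g) p, Quotient.mk (endSetoid g) (rev p)} := by
    ext q
    induction q using Quotient.inductionOn with
    | h a =>
    simp only [Set.mem_ofPred_eq, Set.mem_insert_iff, Set.mem_singleton_iff]
    have e1 : forget g (Quotient.mk _ a) = Quotient.mk _ p ↔ (edgeSetoid g).r a p :=
      Quotient.eq
    have e2 : Quotient.mk (endSetoid g) a = Quotient.mk _ p ↔ (endSetoid g).r a p :=
      Quotient.eq
    have e3 : Quotient.mk (endSetoid g) a = Quotient.mk _ (rev p) ↔ (endSetoid g).r a (rev p) :=
      Quotient.eq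
    rw [e1, e2, e3, edge_iff, end_iff, end_iff]
    exact or_congr Iff.rfl ⟨fun h => sameCycle_rev g h, fun h => sameCycle_rev g h⟩
  have h2 : Nat.card {q // forget g q = Quotient.mk _ p} =
    Set.ncard {q | forget g q = Quotient.mk _ p} := rfl
  rw [h2, this, Set.ncard_pair]
  intro h
  exact not_sameCycle_rev g p ((end_iff g _ _).1 (Quotient.exact h))

theorem card_end : Nat.card (Quotient (endSetoid g)) = 2 * edgeCount g := by
  classical
  haveI := Fintype.ofFinite (Quotient (edgeSetoid g))
  rw [← card_sum_fibers (forget g), Finset.sum_congr rfl (fun c _ => fiber_card g c)]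
  simp [edgeCount, mul_comm]

/-- The endpoint class of an end class. -/
def endpoint : Quotient (endSetoid g) → Quotient (vtxSetoid g) :=
  Quotient.map' (fun p : EdgeEnd => p.1.1) (by
    intro p q h
    change Relation.EqvGen (endRel g) p q at h
    change (vtxSetoid g).r _ _
    induction h with
    | rel a b h =>
      obtain ⟨F, i, j, _, hp, hq⟩ := h
      exact Relation.EqvGen.rel _ _ ⟨F, i, by rw [hp], by rw [hq]⟩
    | refl _ => exact (vtxSetoid g).refl _
    | symm _ _ _ ih => exact (vtxSetoid g).symm ih
    | trans _ _ _ _ _ h1 h2 => exact (vtxSetoid g).trans h1 h2)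

theorem cornerCount_eq (c : Quotient (vtxSetoid g)) :
    cornerCount g c = Nat.card {q // endpoint g q = c} := by
  unfold cornerCount
  refine Nat.card_congr (Equiv.subtypeEquivRight fun q => ?_)
  constructor
  · rintro ⟨p, rfl, h⟩
    exact h
  · induction q using Quotient.inductionOn with
    | h a => exact fun h => ⟨a, rfl, h⟩

end OctaProof

/-- for every orientation-reversing gluing pattern of the faces of the
octahedron, the sum over all vertex classes of the Euler characteristics of the link
surfaces equals `2 e - 6`, where `e` is the number of edge classes. -/
theorem sum_link_euler_characteristics (g : Gluing) :
    ∑ᶠ c : Quotient (vtxSetoid g), linkChi g c = 2 * (edgeCount g : ℤ) - 6 := by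
  classical
  haveI := Fintype.ofFinite (Quotient (vtxSetoid g))
  rw [finsum_eq_sum_of_fintype]
  simp only [linkChi, Finset.sum_sub_distrib]
  have h1 : ∑ c, cornerCount g c = 2 * edgeCount g := by
    rw [← OctaProof.card_end, ← OctaProof.card_sum_fibers (OctaProof.endpoint g)]
    exact Finset.sum_congr rfl fun c _ => OctaProof.cornerCount_eq g c
  have h2 : ∑ c, classSize g c = 6 := by
    have := OctaProof.card_sum_fibers (Quotient.mk (vtxSetoid g))
    simp only [classSize]
    rw [this]
    simp
  have h1' : ∑ c, (cornerCount g c : ℤ) = 2 * edgeCount g := by exact_mod_cast h1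
  have h2' : ∑ c, (classSize g c : ℤ) = 6 := by exact_mod_cast h2
  rw [h1', h2']
end

section
/- An orientation-reversing gluing pattern φ of the faces of the octahedron identifies all 12 edges to a single edge class if and only if φ has a single vertex class and the link of that vertex class is a closed orientable surface of Euler characteristic −4 (equivalently, of genus 3). -/
/-- Reversal of an edge-end. -/
def endRev (p : EdgeEnd) : EdgeEnd := ⟨(p.1.2, p.1.1), fun h => p.2 h.symm⟩

theorem endRev_endRev (p : EdgeEnd) : endRev (endRev p) = p := rfl

theorem endRev_ne (p : EdgeEnd) : endRev p ≠ p := by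
  intro h
  have h1 := congrArg (fun q : EdgeEnd => q.1.2.1) h
  exact p.2 h1

/-- Sign of the flag given by the face `F` and its ordered edge from axis `i` to axis `j`. -/
def flagPos (F : OctFace) (i j : Fin 3) : Bool := Bool.xor (decide (j = i + 1)) (faceSign F)

/-- The unique face in which the edge-end is positive. -/
def posFace (p : EdgeEnd) : OctFace := fun k =>
  if k = p.1.1.1 then p.1.1.2 else if k = p.1.2.1 then p.1.2.2 else
    !(Bool.xor (decide (p.1.2.1 = p.1.1.1 + 1)) (Bool.xor p.1.1.2 p.1.2.2))

theorem posFace_fst (p : EdgeEnd) : posFace p p.1.1.1 = p.1.1.2 := by simp [posFace]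

theorem posFace_snd (p : EdgeEnd) : posFace p p.1.2.1 = p.1.2.2 := by
  have := p.2
  simp [posFace, this.symm]

theorem posFace_pos (p : EdgeEnd) : flagPos (posFace p) p.1.1.1 p.1.2.1 = true := by
  revert p; decide

theorem eq_posFace_aux : ∀ (F : OctFace) (i j : Fin 3) (h : i ≠ j), flagPos F i j = true →
    posFace ⟨((i, F i), (j, F j)), h⟩ = F := by decide

theorem flagPos_swap : ∀ (F : OctFace) (i j : Fin 3), i ≠ j →
    flagPos F j i = !flagPos F i j := by decide

theorem perm_cyc : ∀ (π : Equiv.Perm (Fin 3)) (i j : Fin 3), i ≠ j →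
    (Equiv.Perm.sign π = 1 ↔ (decide (π j = π i + 1) = decide (j = i + 1))) := by decide

/-- The edge-end of `F` from axis `i` to axis `j`. -/
def mkEnd (F : OctFace) (i j : Fin 3) (h : i ≠ j) : EdgeEnd := ⟨((i, F i), (j, F j)), h⟩

theorem flagPos_glue (g : Gluing) (F : OctFace) (i j : Fin 3) (h : i ≠ j) :
    flagPos (g.face F) (g.axisMap F i) (g.axisMap F j) = !flagPos F i j := by
  have h1 := g.2.2.2.2 F
  have h2 := perm_cyc (g.axisMap F) i j h
  change Equiv.Perm.sign (g.axisMap F) = 1 ↔ faceSign F ≠ faceSign (g.face F) at h1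
  rw [h2] at h1
  unfold flagPos
  revert h1
  generalize decide (g.axisMap F j = g.axisMap F i + 1) = a
  generalize decide (j = i + 1) = b
  generalize faceSign F = c
  generalize faceSign (g.face F) = d
  revert a b c d
  decide

/-- Image of an edge-end of `F` under the gluing of `F`. -/
def glueEnd (g : Gluing) (F : OctFace) (i j : Fin 3) (h : i ≠ j) : EdgeEnd :=
  mkEnd (g.face F) (g.axisMap F i) (g.axisMap F j) (fun e => h ((g.axisMap F).injective e))

/-- Rotation around an edge. -/
def rot (g : Gluing) (p : EdgeEnd) : EdgeEnd := glueEnd g (posFace p) p.1.1.1 p.1.2.1 p.2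

theorem rot_mkEnd (g : Gluing) (F : OctFace) (i j : Fin 3) (h : i ≠ j)
    (hp : flagPos F i j = true) : rot g (mkEnd F i j h) = glueEnd g F i j h := by
  have := eq_posFace_aux F i j h hp
  unfold rot
  change glueEnd g (posFace ⟨((i, F i), (j, F j)), h⟩) i j h = _
  rw [this]

theorem mkEnd_posFace (p : EdgeEnd) : mkEnd (posFace p) p.1.1.1 p.1.2.1 p.2 = p := by
  apply Subtype.ext
  simp only [mkEnd, posFace_fst, posFace_snd]

theorem glueEnd_glue (g : Gluing) (F : OctFace) (i j : Fin 3) (h : i ≠ j)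
    (hh : g.axisMap F i ≠ g.axisMap F j) :
    glueEnd g (g.face F) (g.axisMap F i) (g.axisMap F j) hh = mkEnd F i j h := by
  have h1 : g.face (g.face F) = F := g.2.1 F
  have h2 : g.axisMap (g.face F) = (g.axisMap F)⁻¹ := g.2.2.2.1 F
  apply Subtype.ext
  simp [glueEnd, mkEnd, h1, h2]

/-- `rot` of a glued negative flag goes back. -/
theorem rot_glueEnd (g : Gluing) (F : OctFace) (i j : Fin 3) (h : i ≠ j)
    (hp : flagPos F i j = false) : rot g (glueEnd g F i j h) = mkEnd F i j h := by
  have hh : g.axisMap F i ≠ g.axisMap F j := fun e => h ((g.axisMap F).injective e)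
  have := rot_mkEnd g (g.face F) (g.axisMap F i) (g.axisMap F j) hh
    (by rw [flagPos_glue g F i j h, hp]; rfl)
  exact this.trans (glueEnd_glue g F i j h hh)

theorem rot_rev_rot (g : Gluing) (p : EdgeEnd) : rot g (endRev (rot g p)) = endRev p := by
  have hn : flagPos (posFace p) p.1.2.1 p.1.1.1 = false := by
    rw [flagPos_swap _ _ _ p.2, posFace_pos]; rfl
  have := rot_glueEnd g (posFace p) p.1.2.1 p.1.1.1 p.2.symm hn
  have h2 : endRev (mkEnd (posFace p) p.1.1.1 p.1.2.1 p.2) = endRev p := by rw [mkEnd_posFace]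
  exact this.trans h2

/-- Rotation as a permutation. -/
def rotP (g : Gluing) : Equiv.Perm EdgeEnd where
  toFun := rot g
  invFun p := endRev (rot g (endRev p))
  left_inv p := by
    change endRev (rot g (endRev (rot g p))) = p
    rw [rot_rev_rot, endRev_endRev]
  right_inv p := by
    change rot g (endRev (rot g (endRev p))) = p
    rw [rot_rev_rot, endRev_endRev]

theorem rev_rotP (g : Gluing) (p : EdgeEnd) : endRev (rotP g p) = (rotP g)⁻¹ (endRev p) := by
  rw [Equiv.Perm.eq_inv_iff_eq]
  exact rot_rev_rot g p

theorem rev_rotP_inv (g : Gluing) (p : EdgeEnd) : endRev ((rotP g)⁻¹ p) = rotP g (endRev p) := by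
  have := rev_rotP g ((rotP g)⁻¹ p)
  rw [Equiv.Perm.eq_inv_iff_eq] at this
  have h2 : rotP g ((rotP g)⁻¹ p) = p := (rotP g).apply_symm_apply p
  rw [h2] at this
  exact this.symm

theorem rev_rotP_zpow (g : Gluing) (k : ℤ) (p : EdgeEnd) :
    endRev ((rotP g ^ k) p) = (rotP g ^ (-k)) (endRev p) := by
  induction k using Int.induction_on generalizing p with
  | zero => simp
  | succ n ih =>
    rw [zpow_add_one, Equiv.Perm.mul_apply, ih, rev_rotP, neg_add, zpow_add, zpow_neg_one]
    rfl
  | pred n ih =>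
    rw [zpow_sub_one, Equiv.Perm.mul_apply, ih, rev_rotP_inv, neg_sub, sub_neg_eq_add, add_comm 1,
      zpow_add_one, neg_neg]
    rfl

theorem rot_ne_rev (g : Gluing) (p : EdgeEnd) : rotP g p ≠ endRev p := by
  intro h
  change rot g p = endRev p at h
  have hpos := flagPos_glue g (posFace p) p.1.1.1 p.1.2.1 p.2
  rw [posFace_pos] at hpos
  have ha : g.axisMap (posFace p) p.1.1.1 = p.1.2.1 := congrArg (fun q : EdgeEnd => q.1.1.1) h
  have hb : g.axisMap (posFace p) p.1.2.1 = p.1.1.1 := congrArg (fun q : EdgeEnd => q.1.2.1) h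
  have ha2 : g.face (posFace p) (g.axisMap (posFace p) p.1.1.1) = p.1.2.2 :=
    congrArg (fun q : EdgeEnd => q.1.1.2) h
  have hb2 : g.face (posFace p) (g.axisMap (posFace p) p.1.2.1) = p.1.1.2 :=
    congrArg (fun q : EdgeEnd => q.1.2.2) h
  rw [ha] at ha2
  rw [hb] at hb2
  rw [ha, hb, flagPos_swap _ _ _ p.2] at hpos
  have hpos2 : flagPos (g.face (posFace p)) p.1.1.1 p.1.2.1 = true := by simpa using hpos
  have h3 := eq_posFace_aux (g.face (posFace p)) p.1.1.1 p.1.2.1 p.2 hpos2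
  have h4 : (⟨((p.1.1.1, g.face (posFace p) p.1.1.1), (p.1.2.1, g.face (posFace p) p.1.2.1)),
      p.2⟩ : EdgeEnd) = p := by
    apply Subtype.ext
    simp only [ha2, hb2]
  rw [h4] at h3
  exact g.2.2.1 (posFace p) h3.symm

theorem endRel_rot (g : Gluing) (p q : EdgeEnd) (h : endRel g p q) :
    q = rotP g p ∨ p = rotP g q := by
  obtain ⟨F, i, j, hij, hp, hq⟩ := h
  have hpp : p = mkEnd F i j hij := Subtype.ext hp
  have hqq : q = glueEnd g F i j hij := Subtype.ext hq
  subst hpp hqq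
  cases hf : flagPos F i j
  · right; exact (rot_glueEnd g F i j hij hf).symm
  · left; exact (rot_mkEnd g F i j hij hf).symm

theorem eqvGen_zpow (g : Gluing) (p q : EdgeEnd) (h : Relation.EqvGen (endRel g) p q) :
    ∃ k : ℤ, q = (rotP g ^ k) p := by
  induction h with
  | rel x y h =>
    rcases endRel_rot g x y h with h | h
    · exact ⟨1, by simpa using h⟩
    · exact ⟨-1, by rw [zpow_neg_one, Equiv.Perm.eq_inv_iff_eq]; exact h.symm⟩
  | refl x => exact ⟨0, by simp⟩
  | symm x y _ ih =>
    obtain ⟨k, hk⟩ := ih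
    exact ⟨-k, by rw [zpow_neg, Equiv.Perm.eq_inv_iff_eq]; exact hk.symm⟩
  | trans x y z _ _ ih1 ih2 =>
    obtain ⟨k, hk⟩ := ih1
    obtain ⟨l, hl⟩ := ih2
    exact ⟨l + k, by rw [zpow_add, Equiv.Perm.mul_apply, ← hk, hl]⟩

/-- No edge is identified with its own reverse. -/
theorem not_rev (g : Gluing) (p : EdgeEnd) : ¬ Relation.EqvGen (endRel g) p (endRev p) := by
  intro h
  obtain ⟨k, hk⟩ := eqvGen_zpow g _ _ h
  rcases Int.even_or_odd' k with ⟨m, rfl | rfl⟩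
  · apply endRev_ne ((rotP g ^ m) p)
    rw [rev_rotP_zpow, hk, ← Equiv.Perm.mul_apply, ← zpow_add]
    congr 2; ring
  · apply rot_ne_rev g ((rotP g ^ m) p)
    rw [rev_rotP_zpow, hk, ← Equiv.Perm.mul_apply, ← Equiv.Perm.mul_apply, ← zpow_add,
      ← zpow_one_add]
    congr 2; ring

theorem endRel_rev (g : Gluing) (p q : EdgeEnd) (h : endRel g p q) :
    endRel g (endRev p) (endRev q) := by
  obtain ⟨F, i, j, hij, hp, hq⟩ := h
  refine ⟨F, j, i, hij.symm, ?_, ?_⟩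
  · simp [endRev, hp]
  · simp [endRev, hq]

theorem eqv_rev (g : Gluing) (p q : EdgeEnd) (h : Relation.EqvGen (endRel g) p q) :
    Relation.EqvGen (endRel g) (endRev p) (endRev q) := by
  induction h with
  | rel x y h => exact .rel _ _ (endRel_rev g x y h)
  | refl x => exact .refl _
  | symm x y _ ih => exact .symm _ _ ih
  | trans x y z _ _ ih1 ih2 => exact .trans _ _ _ ih1 ih2

theorem edge_iff (g : Gluing) (p q : EdgeEnd) : Relation.EqvGen (edgeRel g) p q ↔
    Relation.EqvGen (endRel g) p q ∨ Relation.EqvGen (endRel g) p (endRev q) := by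
  constructor
  · intro h
    induction h with
    | rel x y h =>
      rcases h with h | h
      · exact .inl (.rel _ _ h)
      · right
        have : y = endRev x := Subtype.ext h
        subst this
        exact .refl _
    | refl x => exact .inl (.refl _)
    | symm x y _ ih =>
      rcases ih with h | h
      · exact .inl (.symm _ _ h)
      · exact .inr (.symm _ _ (eqv_rev g _ _ h))
    | trans x y z _ _ ih1 ih2 =>
      rcases ih1 with h | h <;> rcases ih2 with hh | hh
      · exact .inl (.trans _ _ _ h hh)
      · exact .inr (.trans _ _ _ h hh)
      · exact .inr (.trans _ _ _ h (eqv_rev g _ _ hh))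
      · exact .inl (.trans _ _ _ h (eqv_rev g _ _ hh))
  · have key : ∀ x y, Relation.EqvGen (endRel g) x y → Relation.EqvGen (edgeRel g) x y :=
      fun x y h => Relation.EqvGen.mono (fun a b hab => Or.inl hab) x y h
    rintro (h | h)
    · exact key _ _ h
    · exact .trans _ _ _ (key _ _ h) (.rel _ _ (.inr rfl))

theorem eqv_vtx (g : Gluing) (p q : EdgeEnd) (h : Relation.EqvGen (endRel g) p q) :
    Relation.EqvGen (vtxRel g) p.1.1 q.1.1 := by
  induction h with
  | rel x y h =>
    obtain ⟨F, i, j, hij, hp, hq⟩ := h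
    exact .rel _ _ ⟨F, i, by rw [hp], by rw [hq]⟩
  | refl x => exact .refl _
  | symm x y _ ih => exact .symm _ _ ih
  | trans x y z _ _ ih1 ih2 => exact .trans _ _ _ ih1 ih2

/-- A base edge-end. -/
def baseEnd : EdgeEnd := ⟨((0, true), (1, true)), by decide⟩

theorem edgeCount_one (g : Gluing) : edgeCount g = 1 ↔
    ∀ p, Relation.EqvGen (endRel g) p baseEnd ∨ Relation.EqvGen (endRel g) p (endRev baseEnd) := by
  unfold edgeCount
  rw [Nat.card_eq_one_iff_exists]
  constructor
  · rintro ⟨x, hx⟩ p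
    rw [← edge_iff]
    have : Quotient.mk (edgeSetoid g) p = Quotient.mk (edgeSetoid g) baseEnd :=
      (hx _).trans (hx _).symm
    exact Quotient.exact this
  · intro h
    refine ⟨Quotient.mk (edgeSetoid g) baseEnd, fun y => ?_⟩
    induction y using Quotient.inductionOn with
    | h p => exact Quotient.sound ((edge_iff g p baseEnd).2 (h p))

theorem card_end_two (g : Gluing) : Nat.card (Quotient (endSetoid g)) = 2 ↔
    ∀ p, Relation.EqvGen (endRel g) p baseEnd ∨ Relation.EqvGen (endRel g) p (endRev baseEnd) := by
  have hne : Quotient.mk (endSetoid g) baseEnd ≠ Quotient.mk (endSetoid g) (endRev baseEnd) :=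
    fun h => not_rev g baseEnd (Quotient.exact h)
  constructor
  · intro h p
    rw [Nat.card_eq_two_iff' (Quotient.mk (endSetoid g) baseEnd)] at h
    by_cases hp : Quotient.mk (endSetoid g) p = Quotient.mk (endSetoid g) baseEnd
    · exact .inl (Quotient.exact hp)
    · exact .inr (Quotient.exact (h.unique hp hne.symm))
  · intro h
    rw [Nat.card_eq_two_iff]
    refine ⟨_, _, hne, ?_⟩
    rw [Set.eq_univ_iff_forall]
    intro y
    induction y using Quotient.inductionOn with
    | h p =>
      rcases h p with h | h
      · exact .inl (Quotient.sound h)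
      · exact .inr (Quotient.sound h)

theorem vtx_single (g : Gluing)
    (h : ∀ p, Relation.EqvGen (endRel g) p baseEnd ∨
      Relation.EqvGen (endRel g) p (endRev baseEnd)) : vtxCount g = 1 := by
  let m : OctVertex → Quotient (vtxSetoid g) := Quotient.mk (vtxSetoid g)
  have hm : ∀ p : EdgeEnd, (m p.1.1 = m (0, true) ∧ m p.1.2 = m (1, true)) ∨
      (m p.1.1 = m (1, true) ∧ m p.1.2 = m (0, true)) := by
    intro p
    rcases h p with h | h
    · exact .inl ⟨Quotient.sound (eqv_vtx g _ _ h), Quotient.sound (eqv_vtx g _ _ (eqv_rev g _ _ h))⟩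
    · exact .inr ⟨Quotient.sound (eqv_vtx g _ _ h), Quotient.sound (eqv_vtx g _ _ (eqv_rev g _ _ h))⟩
  have h1 := hm ⟨((0, true), (2, true)), by decide⟩
  have h2 := hm ⟨((1, true), (2, true)), by decide⟩
  have hab : m (0, true) = m (1, true) := by
    simp only at h1 h2
    rcases h1 with h1 | h1 <;> rcases h2 with h2 | h2
    · exact h2.1.symm
    · exact h2.2.symm.trans h1.2
    · exact h1.1
    · exact h1.1
  unfold vtxCount
  rw [Nat.card_eq_one_iff_exists]
  refine ⟨m (0, true), fun y => ?_⟩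
  induction y using Quotient.inductionOn with
  | h v =>
    rcases hm ⟨(v, (v.1 + 1, true)), by revert v; decide⟩ with h | h
    · exact h.1
    · exact h.1.trans hab.symm

theorem linkChi_single (g : Gluing) (h : vtxCount g = 1) (c : Quotient (vtxSetoid g)) :
    linkChi g c = (Nat.card (Quotient (endSetoid g)) : ℤ) - 6 := by
  unfold vtxCount at h
  rw [Nat.card_eq_one_iff_exists] at h
  obtain ⟨x, hx⟩ := h
  have hall : ∀ v, Quotient.mk (vtxSetoid g) v = c := fun v => (hx _).trans (hx _).symm
  have h1 : classSize g c = 6 := by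
    unfold classSize
    rw [Nat.card_congr (Equiv.subtypeUnivEquiv hall)]
    simp
  have h2 : cornerCount g c = Nat.card (Quotient (endSetoid g)) := by
    unfold cornerCount
    refine Nat.card_congr (Equiv.subtypeUnivEquiv fun q => ?_)
    obtain ⟨p, hp⟩ := Quotient.exists_rep q
    exact ⟨p, hp, hall _⟩
  unfold linkChi
  rw [h1, h2]
  rfl

/-- an orientation-reversing gluing pattern of the faces of the octahedron
identifies all `12` edges to a single edge class if and only if it has a single vertex
class whose link is the closed orientable surface of Euler characteristic `-4`
(genus `3`). -/
theorem single_edge_class_iff_genus_three (g : Gluing) :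
    edgeCount g = 1 ↔ (vtxCount g = 1 ∧ ∀ c, linkChi g c = -4) := by
  rw [edgeCount_one]
  constructor
  · intro h
    have hv := vtx_single g h
    refine ⟨hv, fun c => ?_⟩
    rw [linkChi_single g hv c, (card_end_two g).2 h]
    norm_num
  · rintro ⟨hv, hc⟩
    rw [← card_end_two]
    have h1 := hc (Quotient.mk (vtxSetoid g) (0, true))
    rw [linkChi_single g hv] at h1
    omega
end
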